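/- arXiv:1610.06999 — 2 statements merged into one kernel-verified Lean document; each statement's English description precedes it below -/
import Mathlib

section
/- (Proposition 3(i)) Let q* = (q_u*, q_a*) with ∇V_u(q_u*) = 0, and assume (Assumption A7) that M_d(q_u) is positive definite for every q_u ∈ ℝˢ and that the function V_d(q) := k_e k_u V_u(q_u) + ½ ‖ k_a (q_a − q_a*) + (k_a − k_u)( V_N(q_u) − V_N(q_u*) ) ‖²_{K_I} has a strict isolated local minimum at q*. Then the equilibrium (q, q̇) = (q*, 0) is Lyapunov stable for the PID-PBC closed loop with integrator initialization z₁(0) = k_a (q_a(0) − q_a*) + (k_a − k_u)( V_N(q_u(0)) − V_N(q_u*) ): for every ε > 0 there exists δ > 0 such that every PID-PBC closed-loop solution with |q(0) − q*|² + |q̇(0)|² < δ² and the above z₁(0) satisfies |q(t) − q*|² + |q̇(t)|² < ε² for all t ≥ 0; moreover H_d(q, q̇) := ½ q̇ᵀ M_d(q_u) q̇ + V_d(q) is nonincreasing along all such solutions. -/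
open Matrix Set Filter

noncomputable section

/-- Componentwise gradient of a scalar function on `Fin k → ℝ`. -/
def grad {k : ℕ} (f : (Fin k → ℝ) → ℝ) (x : Fin k → ℝ) : Fin k → ℝ :=
  fun i => fderiv ℝ f x (Pi.single i 1)

/-- The block inertia matrix `M(q_u) = [[m_uu, m_auᵀ], [m_au, m_aa]]`. -/
def Mblk {s m : ℕ} (muu : (Fin s → ℝ) → Matrix (Fin s) (Fin s) ℝ)
    (mau : (Fin s → ℝ) → Matrix (Fin m) (Fin s) ℝ)
    (maa : Matrix (Fin m) (Fin m) ℝ) (qu : Fin s → ℝ) :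
    Matrix (Fin s ⊕ Fin m) (Fin s ⊕ Fin m) ℝ :=
  Matrix.fromBlocks (muu qu) (mau qu)ᵀ (mau qu) maa

/-- The Jacobian `J(q, v)` (w.r.t. `q`) of the map `q ↦ M(q_u) v`. -/
def Jmat {s m : ℕ} (muu : (Fin s → ℝ) → Matrix (Fin s) (Fin s) ℝ)
    (mau : (Fin s → ℝ) → Matrix (Fin m) (Fin s) ℝ)
    (maa : Matrix (Fin m) (Fin m) ℝ)
    (q v : (Fin s ⊕ Fin m) → ℝ) :
    Matrix (Fin s ⊕ Fin m) (Fin s ⊕ Fin m) ℝ :=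
  fun i j =>
    fderiv ℝ (fun p : (Fin s ⊕ Fin m) → ℝ =>
      (Mblk muu mau maa (p ∘ Sum.inl) *ᵥ v) i) q (Pi.single j 1)

/-- The Coriolis force vector `C(q, q̇) q̇ = [J(q,q̇) − ½ J(q,q̇)ᵀ] q̇`. -/
def Cvec {s m : ℕ} (muu : (Fin s → ℝ) → Matrix (Fin s) (Fin s) ℝ)
    (mau : (Fin s → ℝ) → Matrix (Fin m) (Fin s) ℝ)
    (maa : Matrix (Fin m) (Fin m) ℝ)
    (q v : (Fin s ⊕ Fin m) → ℝ) : (Fin s ⊕ Fin m) → ℝ :=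
  (Jmat muu mau maa q v - (1/2 : ℝ) • (Jmat muu mau maa q v)ᵀ) *ᵥ v

/-- The Schur complement `m_uu^s(q_u) = m_uu − m_auᵀ m_aa⁻¹ m_au`. -/
def muuS {s m : ℕ} (muu : (Fin s → ℝ) → Matrix (Fin s) (Fin s) ℝ)
    (mau : (Fin s → ℝ) → Matrix (Fin m) (Fin s) ℝ)
    (maa : Matrix (Fin m) (Fin m) ℝ) (qu : Fin s → ℝ) : Matrix (Fin s) (Fin s) ℝ :=
  muu qu - (mau qu)ᵀ * maa⁻¹ * mau qu

/-- `M_a(q_u) = [[m_auᵀ m_aa⁻¹ m_au, m_auᵀ], [m_au, m_aa]]`. -/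
def MaMat {s m : ℕ} (mau : (Fin s → ℝ) → Matrix (Fin m) (Fin s) ℝ)
    (maa : Matrix (Fin m) (Fin m) ℝ) (qu : Fin s → ℝ) :
    Matrix (Fin s ⊕ Fin m) (Fin s ⊕ Fin m) ℝ :=
  Matrix.fromBlocks ((mau qu)ᵀ * maa⁻¹ * mau qu) (mau qu)ᵀ (mau qu) maa

/-- Storage function `H_u(q_u, q̇_u) = ½ q̇_uᵀ m_uu^s(q_u) q̇_u + V_u(q_u)`. -/
def Hu {s m : ℕ} (muu : (Fin s → ℝ) → Matrix (Fin s) (Fin s) ℝ)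
    (mau : (Fin s → ℝ) → Matrix (Fin m) (Fin s) ℝ)
    (maa : Matrix (Fin m) (Fin m) ℝ) (Vu : (Fin s → ℝ) → ℝ)
    (qu vu : Fin s → ℝ) : ℝ :=
  (1/2 : ℝ) * (vu ⬝ᵥ muuS muu mau maa qu *ᵥ vu) + Vu qu

/-- Storage function `H_a(q_u, q̇) = ½ q̇ᵀ M_a(q_u) q̇`. -/
def Ha {s m : ℕ} (mau : (Fin s → ℝ) → Matrix (Fin m) (Fin s) ℝ)
    (maa : Matrix (Fin m) (Fin m) ℝ) (qu : Fin s → ℝ)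
    (qdot : (Fin s ⊕ Fin m) → ℝ) : ℝ :=
  (1/2 : ℝ) * (qdot ⬝ᵥ MaMat mau maa qu *ᵥ qdot)

/-- Passive output `y_u = −m_aa⁻¹ m_au(q_u) q̇_u`. -/
def yU {s m : ℕ} (mau : (Fin s → ℝ) → Matrix (Fin m) (Fin s) ℝ)
    (maa : Matrix (Fin m) (Fin m) ℝ) (qu vu : Fin s → ℝ) : Fin m → ℝ :=
  -(maa⁻¹ *ᵥ (mau qu *ᵥ vu))

/-- Passive output `y_a = m_aa⁻¹ m_au(q_u) q̇_u + q̇_a`. -/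
def yA {s m : ℕ} (mau : (Fin s → ℝ) → Matrix (Fin m) (Fin s) ℝ)
    (maa : Matrix (Fin m) (Fin m) ℝ) (qu vu : Fin s → ℝ) (va : Fin m → ℝ) : Fin m → ℝ :=
  maa⁻¹ *ᵥ (mau qu *ᵥ vu) + va

/-- The signal `y_d = k_a y_a + k_u y_u` along a trajectory. -/
def ydSig {s m : ℕ} (mau : (Fin s → ℝ) → Matrix (Fin m) (Fin s) ℝ)
    (maa : Matrix (Fin m) (Fin m) ℝ) (ka ku : ℝ)
    (q qd : ℝ → (Fin s ⊕ Fin m) → ℝ) (t : ℝ) : Fin m → ℝ :=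
  ka • yA mau maa (q t ∘ Sum.inl) (qd t ∘ Sum.inl) (qd t ∘ Sum.inr)
    + ku • yU mau maa (q t ∘ Sum.inl) (qd t ∘ Sum.inl)

/-- The desired inertia matrix `M_d(q_u)`. -/
def MdMat {s m : ℕ} (muu : (Fin s → ℝ) → Matrix (Fin s) (Fin s) ℝ)
    (mau : (Fin s → ℝ) → Matrix (Fin m) (Fin s) ℝ)
    (maa : Matrix (Fin m) (Fin m) ℝ) (KD : Matrix (Fin m) (Fin m) ℝ)
    (ke ka ku : ℝ) (qu : Fin s → ℝ) :
    Matrix (Fin s ⊕ Fin m) (Fin s ⊕ Fin m) ℝ :=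
  Matrix.fromBlocks
    ((ke * ku) • muuS muu mau maa qu + (ke * ka) • ((mau qu)ᵀ * maa⁻¹ * mau qu)
      + ((ka - ku)^2) • ((mau qu)ᵀ * maa⁻¹ * KD * maa⁻¹ * mau qu))
    ((ke * ka) • (mau qu)ᵀ + (ka * (ka - ku)) • ((mau qu)ᵀ * maa⁻¹ * KD))
    ((ke * ka) • mau qu + (ka * (ka - ku)) • (KD * maa⁻¹ * mau qu))
    ((ke * ka) • maa + (ka^2) • KD)

/-- A PID-PBC closed-loop solution: a trajectory of the mechanical system together with
the integrator state `z₁` satisfying `ż₁ = y_d` and the PID relation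
`k_e u = −(K_P y_d + K_I z₁ + K_D ẏ_d)`, where `u = τ − ∇V_a(q_a)`. -/
structure Sol {s m : ℕ} (muu : (Fin s → ℝ) → Matrix (Fin s) (Fin s) ℝ)
    (mau : (Fin s → ℝ) → Matrix (Fin m) (Fin s) ℝ)
    (maa : Matrix (Fin m) (Fin m) ℝ)
    (Vu : (Fin s → ℝ) → ℝ) (Va : (Fin m → ℝ) → ℝ)
    (ke ka ku : ℝ) (KP KI KD : Matrix (Fin m) (Fin m) ℝ) where
  q : ℝ → (Fin s ⊕ Fin m) → ℝ
  qd : ℝ → (Fin s ⊕ Fin m) → ℝ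
  qdd : ℝ → (Fin s ⊕ Fin m) → ℝ
  τ : ℝ → Fin m → ℝ
  z₁ : ℝ → Fin m → ℝ
  ydd : ℝ → Fin m → ℝ
  hτ : ContinuousOn τ (Ici 0)
  hq : ∀ t ∈ Ici (0:ℝ), HasDerivWithinAt q (qd t) (Ici 0) t
  hqd : ∀ t ∈ Ici (0:ℝ), HasDerivWithinAt qd (qdd t) (Ici 0) t
  hqdd : ContinuousOn qdd (Ici 0)
  hEL : ∀ t ∈ Ici (0:ℝ),
    Mblk muu mau maa (q t ∘ Sum.inl) *ᵥ qdd t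
      + Cvec muu mau maa (q t) (qd t)
      + Sum.elim (grad Vu (q t ∘ Sum.inl)) (grad Va (q t ∘ Sum.inr))
    = Sum.elim (0 : Fin s → ℝ) (τ t)
  hz₁ : ∀ t ∈ Ici (0:ℝ), HasDerivWithinAt z₁ (ydSig mau maa ka ku q qd t) (Ici 0) t
  hydd : ∀ t ∈ Ici (0:ℝ), HasDerivWithinAt (ydSig mau maa ka ku q qd) (ydd t) (Ici 0) t
  hPID : ∀ t ∈ Ici (0:ℝ),
    ke • (τ t - grad Va (q t ∘ Sum.inr))
      = -(KP *ᵥ ydSig mau maa ka ku q qd t + KI *ᵥ z₁ t + KD *ᵥ ydd t)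

/-- The desired potential energy `V_d(q)`. -/
def VdFun {s m : ℕ} (Vu : (Fin s → ℝ) → ℝ) (VN : (Fin s → ℝ) → Fin m → ℝ)
    (KI : Matrix (Fin m) (Fin m) ℝ) (ke ka ku : ℝ)
    (qus : Fin s → ℝ) (qas : Fin m → ℝ) (qq : (Fin s ⊕ Fin m) → ℝ) : ℝ :=
  ke * ku * Vu (qq ∘ Sum.inl)
    + (1/2 : ℝ) * ((ka • (qq ∘ Sum.inr - qas) + (ka - ku) • (VN (qq ∘ Sum.inl) - VN qus)) ⬝ᵥ
        KI *ᵥ (ka • (qq ∘ Sum.inr - qas) + (ka - ku) • (VN (qq ∘ Sum.inl) - VN qus)))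

/-- The desired total energy (Lyapunov function) `H_d(q, q̇) = ½ q̇ᵀ M_d(q_u) q̇ + V_d(q)`. -/
def HdFun {s m : ℕ} (muu : (Fin s → ℝ) → Matrix (Fin s) (Fin s) ℝ)
    (mau : (Fin s → ℝ) → Matrix (Fin m) (Fin s) ℝ)
    (maa : Matrix (Fin m) (Fin m) ℝ) (KD : Matrix (Fin m) (Fin m) ℝ)
    (Vu : (Fin s → ℝ) → ℝ) (VN : (Fin s → ℝ) → Fin m → ℝ)
    (KI : Matrix (Fin m) (Fin m) ℝ) (ke ka ku : ℝ)
    (qus : Fin s → ℝ) (qas : Fin m → ℝ)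
    (qq qdot : (Fin s ⊕ Fin m) → ℝ) : ℝ :=
  (1/2 : ℝ) * (qdot ⬝ᵥ MdMat muu mau maa KD ke ka ku (qq ∘ Sum.inl) *ᵥ qdot)
    + VdFun Vu VN KI ke ka ku qus qas qq

theorem HasDerivWithinAt.dotProduct {ι : Type*} [Fintype ι] {x y : ℝ → ι → ℝ} {x' y' : ι → ℝ}
    {S : Set ℝ} {t : ℝ} (hx : HasDerivWithinAt x x' S t) (hy : HasDerivWithinAt y y' S t) :
    HasDerivWithinAt (fun t => x t ⬝ᵥ y t) (x' ⬝ᵥ y t + x t ⬝ᵥ y') S t := by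
  have h := HasDerivWithinAt.fun_sum (u := Finset.univ) fun i _ =>
    (hasDerivWithinAt_pi.1 hx i).fun_mul (hasDerivWithinAt_pi.1 hy i)
  exact h.congr_deriv Finset.sum_add_distrib

theorem HasDerivWithinAt.const_mulVec {ι κ : Type*} [Fintype ι] [Fintype κ] (K : Matrix κ ι ℝ)
    {x : ℝ → ι → ℝ} {x' : ι → ℝ} {S : Set ℝ} {t : ℝ} (hx : HasDerivWithinAt x x' S t) :
    HasDerivWithinAt (fun t => K *ᵥ x t) (K *ᵥ x') S t := by
  refine hasDerivWithinAt_pi.2 fun i => ?_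
  simpa [mulVec] using (hasDerivWithinAt_const t S (K i)).dotProduct hx

theorem Matrix.IsSymm.dotProduct_mulVec_comm {ι : Type*} [Fintype ι] {K : Matrix ι ι ℝ}
    (hK : K.IsSymm) (x y : ι → ℝ) : x ⬝ᵥ K *ᵥ y = y ⬝ᵥ K *ᵥ x := by
  rw [dotProduct_mulVec, ← mulVec_transpose, hK.eq, dotProduct_comm]

theorem HasDerivWithinAt.half_quadratic {ι : Type*} [Fintype ι] {K : Matrix ι ι ℝ}
    (hK : K.IsSymm) {x : ℝ → ι → ℝ} {x' : ι → ℝ} {S : Set ℝ} {t : ℝ}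
    (hx : HasDerivWithinAt x x' S t) :
    HasDerivWithinAt (fun t => (1/2 : ℝ) * (x t ⬝ᵥ K *ᵥ x t)) (x t ⬝ᵥ K *ᵥ x') S t := by
  refine ((hx.dotProduct (hx.const_mulVec K)).const_mul (1/2 : ℝ)).congr_deriv ?_
  rw [hK.dotProduct_mulVec_comm x' (x t)]
  ring

theorem HasDerivWithinAt.comp_inl {α β : Type*} [Fintype α] [Fintype β] {q : ℝ → α ⊕ β → ℝ}
    {v : α ⊕ β → ℝ} {S : Set ℝ} {t : ℝ} (hq : HasDerivWithinAt q v S t) :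
    HasDerivWithinAt (fun t => q t ∘ Sum.inl) (v ∘ Sum.inl) S t :=
  hasDerivWithinAt_pi.2 fun i => hasDerivWithinAt_pi.1 hq (Sum.inl i)

theorem HasDerivWithinAt.comp_inr {α β : Type*} [Fintype α] [Fintype β] {q : ℝ → α ⊕ β → ℝ}
    {v : α ⊕ β → ℝ} {S : Set ℝ} {t : ℝ} (hq : HasDerivWithinAt q v S t) :
    HasDerivWithinAt (fun t => q t ∘ Sum.inr) (v ∘ Sum.inr) S t :=
  hasDerivWithinAt_pi.2 fun i => hasDerivWithinAt_pi.1 hq (Sum.inr i)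

theorem sum_apply_single_mul {ι : Type*} [Fintype ι] [DecidableEq ι] (L : (ι → ℝ) →L[ℝ] ℝ)
    (v : ι → ℝ) : ∑ i, L (Pi.single i 1) * v i = L v := by
  conv_rhs => rw [← Finset.univ_sum_single v, map_sum]
  refine Finset.sum_congr rfl fun i _ => ?_
  have h : (Pi.single i (v i) : ι → ℝ) = v i • Pi.single i 1 := by
    rw [← Pi.single_smul', smul_eq_mul, mul_one]
  rw [h, map_smul, smul_eq_mul, mul_comm]

theorem grad_dotProduct {k : ℕ} (f : (Fin k → ℝ) → ℝ) (x v : Fin k → ℝ) :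
    grad f x ⬝ᵥ v = fderiv ℝ f x v :=
  sum_apply_single_mul _ _

/-- If `H` exceeds `H p` on a compact level set `W = ρ`, then a curve along which `H` never exceeds
its initial value and which starts close to `p` inside `W < ρ` stays there. -/
theorem exists_trapping_radius {X : Type*} [TopologicalSpace X] {H W : X → ℝ} {p : X} {ρ : ℝ}
    (hH : Continuous H) (hW : Continuous W) (hK : IsCompact {x | W x = ρ})
    (hpos : ∀ x, W x = ρ → H p < H x) :
    ∃ U ∈ nhds p, ∀ x : ℝ → X, ContinuousOn x (Ici 0) →
      (∀ t ∈ Ici (0 : ℝ), H (x t) ≤ H (x 0)) → x 0 ∈ U → W (x 0) < ρ →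
      ∀ t ∈ Ici (0 : ℝ), W (x t) < ρ := by
  obtain ⟨c, hc, hcK⟩ := hK.exists_forall_le' hH.continuousOn hpos
  refine ⟨{x | H x < c}, (isOpen_lt hH continuous_const).mem_nhds hc, ?_⟩
  intro x hx hmono h0 hW0 t ht
  by_contra! hcon
  have hcont : ContinuousOn (fun τ => W (x τ)) (Icc 0 t) :=
    hW.comp_continuousOn (hx.mono Icc_subset_Ici_self)
  obtain ⟨τ, hτ, hτρ⟩ := intermediate_value_Icc ht hcont ⟨hW0.le, hcon⟩
  exact absurd (h0 : H (x 0) < c) (not_lt.2 ((hcK _ hτρ).trans (hmono τ hτ.1)))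

section Blocks

variable {s m : ℕ} {muu : (Fin s → ℝ) → Matrix (Fin s) (Fin s) ℝ}
  {mau : (Fin s → ℝ) → Matrix (Fin m) (Fin s) ℝ} {maa : Matrix (Fin m) (Fin m) ℝ}

theorem Mblk_entry_contDiff (hmuu : ∀ i j, ContDiff ℝ (⊤ : ℕ∞) fun x => muu x i j)
    (hmau : ∀ i j, ContDiff ℝ (⊤ : ℕ∞) fun x => mau x i j) (i j : Fin s ⊕ Fin m) :
    ContDiff ℝ (⊤ : ℕ∞) fun p : Fin s ⊕ Fin m → ℝ => Mblk muu mau maa (p ∘ Sum.inl) i j := by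
  have hp : ContDiff ℝ (⊤ : ℕ∞) fun p : Fin s ⊕ Fin m → ℝ => p ∘ Sum.inl :=
    contDiff_pi.2 fun k => contDiff_apply ℝ ℝ (Sum.inl k)
  rcases i with i | i <;> rcases j with j | j
  · exact (hmuu i j).comp hp
  · exact (hmau j i).comp hp
  · exact (hmau i j).comp hp
  · exact contDiff_const

theorem maa_posDef (hM : ∀ qu, (Mblk muu mau maa qu).PosDef) : maa.PosDef :=
  (hM 0).submatrix Sum.inr_injective

theorem Jmat_mulVec (q v w : Fin s ⊕ Fin m → ℝ) (i : Fin s ⊕ Fin m) :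
    (Jmat muu mau maa q v *ᵥ w) i =
      fderiv ℝ (fun p : Fin s ⊕ Fin m → ℝ => (Mblk muu mau maa (p ∘ Sum.inl) *ᵥ v) i) q w :=
  sum_apply_single_mul (fderiv ℝ (fun p : Fin s ⊕ Fin m → ℝ =>
    (Mblk muu mau maa (p ∘ Sum.inl) *ᵥ v) i) q) w

/-- The inertia matrix does not depend on the actuated coordinates. -/
theorem Jmat_inr (hmuu : ∀ i j, ContDiff ℝ (⊤ : ℕ∞) fun x => muu x i j)
    (hmau : ∀ i j, ContDiff ℝ (⊤ : ℕ∞) fun x => mau x i j)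
    (q v : Fin s ⊕ Fin m → ℝ) (i : Fin s ⊕ Fin m) (k : Fin m) :
    Jmat muu mau maa q v i (Sum.inr k) = 0 := by
  have hd : DifferentiableAt ℝ
      (fun p : Fin s ⊕ Fin m → ℝ => (Mblk muu mau maa (p ∘ Sum.inl) *ᵥ v) i) q := by
    simp only [mulVec, dotProduct]
    refine DifferentiableAt.fun_sum fun j _ => ?_
    exact ((Mblk_entry_contDiff hmuu hmau i j).differentiable (by simp) q).mul_const _
  have h := (hd.hasFDerivAt.hasLineDerivAt (Pi.single (Sum.inr k) 1)).lineDeriv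
  have hcomp : ∀ a : ℝ, (q + a • Pi.single (Sum.inr k) (1 : ℝ)) ∘ Sum.inl = q ∘ Sum.inl := by
    intro a
    ext j
    simp
  rw [Jmat, ← h, lineDeriv]
  simp only [hcomp, deriv_const]

theorem hasDerivWithinAt_momentum (hmuu : ∀ i j, ContDiff ℝ (⊤ : ℕ∞) fun x => muu x i j)
    (hmau : ∀ i j, ContDiff ℝ (⊤ : ℕ∞) fun x => mau x i j)
    {q v : ℝ → Fin s ⊕ Fin m → ℝ} {q' v' : Fin s ⊕ Fin m → ℝ} {S : Set ℝ} {t : ℝ}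
    (hq : HasDerivWithinAt q q' S t) (hv : HasDerivWithinAt v v' S t) :
    HasDerivWithinAt (fun t => Mblk muu mau maa (q t ∘ Sum.inl) *ᵥ v t)
      (Mblk muu mau maa (q t ∘ Sum.inl) *ᵥ v' + Jmat muu mau maa (q t) (v t) *ᵥ q') S t := by
  refine hasDerivWithinAt_pi.2 fun i => ?_
  have hentry : ∀ j, HasFDerivAt
      (fun p : Fin s ⊕ Fin m → ℝ => Mblk muu mau maa (p ∘ Sum.inl) i j)
      (fderiv ℝ (fun p : Fin s ⊕ Fin m → ℝ => Mblk muu mau maa (p ∘ Sum.inl) i j) (q t)) (q t) :=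
    fun j => ((Mblk_entry_contDiff hmuu hmau i j).differentiable (by simp) (q t)).hasFDerivAt
  have hJ := (HasFDerivAt.fun_sum (u := Finset.univ) fun j _ =>
    (hentry j).mul_const (v t j)).fderiv
  have h := HasDerivWithinAt.fun_sum (u := Finset.univ) fun j _ =>
    ((hentry j).comp_hasDerivWithinAt t hq).fun_mul (hasDerivWithinAt_pi.1 hv j)
  refine h.congr_deriv ?_
  rw [Pi.add_apply, Jmat_mulVec]
  simp only [mulVec, dotProduct]
  rw [hJ]
  simp [Finset.sum_add_distrib, add_comm, mul_comm]

theorem qd_dotProduct_Cvec (q v : Fin s ⊕ Fin m → ℝ) :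
    v ⬝ᵥ Cvec muu mau maa q v = (1/2 : ℝ) * (v ⬝ᵥ Jmat muu mau maa q v *ᵥ v) := by
  have h : v ⬝ᵥ (Jmat muu mau maa q v)ᵀ *ᵥ v = v ⬝ᵥ Jmat muu mau maa q v *ᵥ v := by
    rw [dotProduct_mulVec, vecMul_transpose, dotProduct_comm]
  rw [Cvec, sub_mulVec, smul_mulVec, dotProduct_sub, dotProduct_smul, h, smul_eq_mul]
  ring

theorem Cvec_inr (hmuu : ∀ i j, ContDiff ℝ (⊤ : ℕ∞) fun x => muu x i j)
    (hmau : ∀ i j, ContDiff ℝ (⊤ : ℕ∞) fun x => mau x i j)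
    (q v : Fin s ⊕ Fin m → ℝ) (k : Fin m) :
    Cvec muu mau maa q v (Sum.inr k) = (Jmat muu mau maa q v *ᵥ v) (Sum.inr k) := by
  have h : ((Jmat muu mau maa q v)ᵀ *ᵥ v) (Sum.inr k) = 0 :=
    Finset.sum_eq_zero (s := Finset.univ)
      (f := fun i => Jmat muu mau maa q v i (Sum.inr k) * v i) fun i _ => by
        rw [Jmat_inr hmuu hmau, zero_mul]
  rw [Cvec, sub_mulVec, smul_mulVec, Pi.sub_apply, Pi.smul_apply, h, smul_zero, sub_zero]

/-- The kinetic part of `H_d` in terms of the mechanical kinetic energy, the actuated momentum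
`p = m_au q̇_u + m_aa q̇_a` and the output `y_d`. -/
theorem MdMat_quadratic (hmaa : maa.IsSymm) (hunit : IsUnit maa.det)
    {KD : Matrix (Fin m) (Fin m) ℝ} (hKD : KD.IsSymm) (ke ka ku : ℝ) (qu vu : Fin s → ℝ)
    (va : Fin m → ℝ) :
    Sum.elim vu va ⬝ᵥ MdMat muu mau maa KD ke ka ku qu *ᵥ Sum.elim vu va =
      ke * ku * (Sum.elim vu va ⬝ᵥ Mblk muu mau maa qu *ᵥ Sum.elim vu va)
      + ke * (ka - ku) * ((mau qu *ᵥ vu + maa *ᵥ va) ⬝ᵥ maa⁻¹ *ᵥ (mau qu *ᵥ vu + maa *ᵥ va))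
      + (ka • yA mau maa qu vu va + ku • yU mau maa qu vu) ⬝ᵥ
          KD *ᵥ (ka • yA mau maa qu vu va + ku • yU mau maa qu vu) := by
  have hinv : maa⁻¹.IsSymm := by rw [IsSymm, transpose_nonsing_inv, hmaa.eq]
  have htr : ∀ z : Fin m → ℝ, vu ⬝ᵥ (mau qu)ᵀ *ᵥ z = (mau qu *ᵥ vu) ⬝ᵥ z := fun z => by
    rw [dotProduct_mulVec, vecMul_transpose]
  have hcancel : ∀ z : Fin m → ℝ, maa⁻¹ *ᵥ maa *ᵥ z = z := fun z => by
    rw [mulVec_mulVec, nonsing_inv_mul _ hunit, one_mulVec]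
  have hcancel' : ∀ z : Fin m → ℝ, maa *ᵥ maa⁻¹ *ᵥ z = z := fun z => by
    rw [mulVec_mulVec, mul_nonsing_inv _ hunit, one_mulVec]
  simp only [MdMat, Mblk, muuS, yA, yU, fromBlocks_mulVec, Sum.elim_comp_inl, Sum.elim_comp_inr,
    sumElim_dotProduct_sumElim, add_mulVec, sub_mulVec, smul_mulVec, mulVec_add, mulVec_neg,
    mulVec_smul, ← mulVec_mulVec, dotProduct_add, add_dotProduct, dotProduct_sub,
    dotProduct_smul, smul_dotProduct, dotProduct_neg, neg_dotProduct, smul_eq_mul, htr, hcancel]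
  generalize mau qu *ᵥ vu = w
  have h1 : w ⬝ᵥ maa⁻¹ *ᵥ KD *ᵥ maa⁻¹ *ᵥ w = (maa⁻¹ *ᵥ w) ⬝ᵥ KD *ᵥ maa⁻¹ *ᵥ w := by
    rw [hinv.dotProduct_mulVec_comm, dotProduct_comm]
  have h2 : w ⬝ᵥ maa⁻¹ *ᵥ KD *ᵥ va = va ⬝ᵥ KD *ᵥ maa⁻¹ *ᵥ w := by
    rw [hinv.dotProduct_mulVec_comm, dotProduct_comm, hKD.dotProduct_mulVec_comm]
  have h3 : (maa⁻¹ *ᵥ w) ⬝ᵥ KD *ᵥ va = va ⬝ᵥ KD *ᵥ maa⁻¹ *ᵥ w :=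
    hKD.dotProduct_mulVec_comm _ _
  have h4 : (maa *ᵥ va) ⬝ᵥ maa⁻¹ *ᵥ w = va ⬝ᵥ w := by
    rw [dotProduct_comm, hmaa.dotProduct_mulVec_comm, hcancel']
  have h5 : w ⬝ᵥ va = va ⬝ᵥ w := dotProduct_comm _ _
  have h6 : (maa *ᵥ va) ⬝ᵥ va = va ⬝ᵥ maa *ᵥ va := dotProduct_comm _ _
  rw [h1, h2, h3, h4, h5, h6]
  ring


section Solutions

variable {Vu : (Fin s → ℝ) → ℝ} {Va : (Fin m → ℝ) → ℝ} {ke ka ku : ℝ}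
  {KP KI KD : Matrix (Fin m) (Fin m) ℝ}

theorem Sol.hasDerivWithinAt_energy (hmuu : ∀ i j, ContDiff ℝ (⊤ : ℕ∞) fun x => muu x i j)
    (hmau : ∀ i j, ContDiff ℝ (⊤ : ℕ∞) fun x => mau x i j)
    (hM : ∀ qu, (Mblk muu mau maa qu).PosDef) (hVu : ContDiff ℝ (⊤ : ℕ∞) Vu)
    (sol : Sol muu mau maa Vu Va ke ka ku KP KI KD) {t : ℝ} (ht : t ∈ Ici (0 : ℝ)) :
    HasDerivWithinAt
      (fun t => (1/2 : ℝ) * (sol.qd t ⬝ᵥ Mblk muu mau maa (sol.q t ∘ Sum.inl) *ᵥ sol.qd t)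
        + Vu (sol.q t ∘ Sum.inl))
      ((sol.qd t ∘ Sum.inr) ⬝ᵥ (sol.τ t - grad Va (sol.q t ∘ Sum.inr))) (Ici 0) t := by
  have hsymm : (Mblk muu mau maa (sol.q t ∘ Sum.inl)).IsSymm :=
    (conjTranspose_eq_transpose_of_trivial _).symm.trans (hM _).isHermitian
  have hkin := (((sol.hqd t ht).dotProduct
    (hasDerivWithinAt_momentum (maa := maa) hmuu hmau (sol.hq t ht) (sol.hqd t ht))).const_mul
      (1/2 : ℝ))
  have hpot := ((hVu.differentiable (by simp)
    (sol.q t ∘ Sum.inl)).hasFDerivAt).comp_hasDerivWithinAt t (sol.hq t ht).comp_inl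
  refine (hkin.fun_add hpot).congr_deriv ?_
  have hEL := congrArg (fun z => sol.qd t ⬝ᵥ z) (sol.hEL t ht)
  have hsplit : ∀ (a : Fin s → ℝ) (b : Fin m → ℝ), sol.qd t ⬝ᵥ Sum.elim a b =
      (sol.qd t ∘ Sum.inl) ⬝ᵥ a + (sol.qd t ∘ Sum.inr) ⬝ᵥ b := fun a b => by
    rw [← sumElim_dotProduct_sumElim, Sum.elim_comp_inl_inr]
  simp only [dotProduct_add, qd_dotProduct_Cvec, hsplit, dotProduct_zero] at hEL
  rw [← grad_dotProduct, dotProduct_comm (grad Vu _), dotProduct_add,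
    hsymm.dotProduct_mulVec_comm (sol.qdd t), dotProduct_sub]
  linarith

theorem Sol.hasDerivWithinAt_actuated_momentum
    (hmuu : ∀ i j, ContDiff ℝ (⊤ : ℕ∞) fun x => muu x i j)
    (hmau : ∀ i j, ContDiff ℝ (⊤ : ℕ∞) fun x => mau x i j)
    (sol : Sol muu mau maa Vu Va ke ka ku KP KI KD) {t : ℝ} (ht : t ∈ Ici (0 : ℝ)) :
    HasDerivWithinAt
      (fun t => mau (sol.q t ∘ Sum.inl) *ᵥ (sol.qd t ∘ Sum.inl) + maa *ᵥ (sol.qd t ∘ Sum.inr))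
      (sol.τ t - grad Va (sol.q t ∘ Sum.inr)) (Ici 0) t := by
  have h := (hasDerivWithinAt_momentum (maa := maa) hmuu hmau
    (sol.hq t ht) (sol.hqd t ht)).comp_inr
  simp only [Mblk, fromBlocks_mulVec, Sum.elim_comp_inr] at h
  refine h.congr_deriv ?_
  ext k
  have hEL := congrFun (sol.hEL t ht) (Sum.inr k)
  simp only [Pi.add_apply, Cvec_inr hmuu hmau, Sum.elim_inr, Mblk, fromBlocks_mulVec] at hEL
  simp only [Function.comp_apply, Pi.add_apply, Sum.elim_inr, Pi.sub_apply]
  linarith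

theorem Sol.integrator_eq {VN : (Fin s → ℝ) → Fin m → ℝ} (hVNs : ContDiff ℝ (⊤ : ℕ∞) VN)
    (hVN : ∀ x v, fderiv ℝ VN x v = (maa⁻¹ * mau x) *ᵥ v) (qus : Fin s → ℝ) (qas : Fin m → ℝ)
    (sol : Sol muu mau maa Vu Va ke ka ku KP KI KD)
    (h0 : sol.z₁ 0 = ka • (sol.q 0 ∘ Sum.inr - qas)
      + (ka - ku) • (VN (sol.q 0 ∘ Sum.inl) - VN qus)) {t : ℝ} (ht : t ∈ Ici (0 : ℝ)) :
    sol.z₁ t = ka • (sol.q t ∘ Sum.inr - qas) + (ka - ku) • (VN (sol.q t ∘ Sum.inl) - VN qus) := by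
  have hd : ∀ τ ∈ Ici (0 : ℝ), HasDerivWithinAt
      (fun t => ka • (sol.q t ∘ Sum.inr - qas) + (ka - ku) • (VN (sol.q t ∘ Sum.inl) - VN qus))
      (ydSig mau maa ka ku sol.q sol.qd τ) (Ici 0) τ := by
    intro τ hτ
    have hN := ((hVNs.differentiable (by simp)
      (sol.q τ ∘ Sum.inl)).hasFDerivAt).comp_hasDerivWithinAt τ (sol.hq τ hτ).comp_inl
    refine ((((sol.hq τ hτ).comp_inr.sub_const qas).const_smul ka).fun_add
      ((hN.sub_const (VN qus)).const_smul (ka - ku))).congr_deriv ?_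
    rw [hVN, ydSig, yA, yU, ← mulVec_mulVec]
    module
  have hIcc : Ico 0 t ⊆ Ici (0 : ℝ) := Ico_subset_Ici_self
  refine eq_of_has_deriv_right_eq (f' := ydSig mau maa ka ku sol.q sol.qd)
    (fun x hx => (sol.hz₁ x (hIcc hx)).mono (Ici_subset_Ici.2 hx.1))
    (fun x hx => (hd x (hIcc hx)).mono (Ici_subset_Ici.2 hx.1))
    (fun x hx => (sol.hz₁ x hx.1).continuousWithinAt.mono Icc_subset_Ici_self)
    (fun x hx => (hd x hx.1).continuousWithinAt.mono Icc_subset_Ici_self) h0 t ⟨ht, le_rfl⟩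

theorem Sol.antitoneOn_HdFun (hmuu : ∀ i j, ContDiff ℝ (⊤ : ℕ∞) fun x => muu x i j)
    (hmau : ∀ i j, ContDiff ℝ (⊤ : ℕ∞) fun x => mau x i j) (hmaa : maa.IsSymm)
    (hM : ∀ qu, (Mblk muu mau maa qu).PosDef) (hVu : ContDiff ℝ (⊤ : ℕ∞) Vu)
    (hKP : KP.PosDef) (hKI : KI.PosDef) (hKD : KD.PosSemidef)
    {VN : (Fin s → ℝ) → Fin m → ℝ} (hVNs : ContDiff ℝ (⊤ : ℕ∞) VN)
    (hVN : ∀ x v, fderiv ℝ VN x v = (maa⁻¹ * mau x) *ᵥ v) (qus : Fin s → ℝ) (qas : Fin m → ℝ)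
    (sol : Sol muu mau maa Vu Va ke ka ku KP KI KD)
    (h0 : sol.z₁ 0 = ka • (sol.q 0 ∘ Sum.inr - qas)
      + (ka - ku) • (VN (sol.q 0 ∘ Sum.inl) - VN qus)) :
    AntitoneOn (fun t => HdFun muu mau maa KD Vu VN KI ke ka ku qus qas (sol.q t) (sol.qd t))
      (Ici 0) := by
  have hunit : IsUnit maa.det := (isUnit_iff_isUnit_det _).1 (maa_posDef hM).isUnit
  have hinv : maa⁻¹.IsSymm := by rw [IsSymm, transpose_nonsing_inv, hmaa.eq]
  have hKIs : KI.IsSymm := (conjTranspose_eq_transpose_of_trivial _).symm.trans hKI.isHermitian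
  have hKDs : KD.IsSymm := (conjTranspose_eq_transpose_of_trivial _).symm.trans hKD.isHermitian
  have hH : ∀ t ∈ Ici (0 : ℝ),
      HdFun muu mau maa KD Vu VN KI ke ka ku qus qas (sol.q t) (sol.qd t) =
        ke * ku * ((1/2 : ℝ) * (sol.qd t ⬝ᵥ Mblk muu mau maa (sol.q t ∘ Sum.inl) *ᵥ sol.qd t)
          + Vu (sol.q t ∘ Sum.inl))
        + ke * (ka - ku) * ((1/2 : ℝ) *
          ((mau (sol.q t ∘ Sum.inl) *ᵥ (sol.qd t ∘ Sum.inl) + maa *ᵥ (sol.qd t ∘ Sum.inr)) ⬝ᵥ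
            maa⁻¹ *ᵥ
          (mau (sol.q t ∘ Sum.inl) *ᵥ (sol.qd t ∘ Sum.inl) + maa *ᵥ (sol.qd t ∘ Sum.inr))))
        + (1/2 : ℝ) * (ydSig mau maa ka ku sol.q sol.qd t ⬝ᵥ
            KD *ᵥ ydSig mau maa ka ku sol.q sol.qd t)
        + (1/2 : ℝ) * (sol.z₁ t ⬝ᵥ KI *ᵥ sol.z₁ t) := by
    intro t ht
    have hquad := MdMat_quadratic (muu := muu) (mau := mau) hmaa hunit hKDs ke ka ku
      (sol.q t ∘ Sum.inl) (sol.qd t ∘ Sum.inl) (sol.qd t ∘ Sum.inr)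
    rw [Sum.elim_comp_inl_inr] at hquad
    rw [HdFun, VdFun, ← sol.integrator_eq hVNs hVN qus qas h0 ht, hquad, ydSig]
    ring
  have hderiv : ∀ t ∈ Ici (0 : ℝ), HasDerivWithinAt
      (fun t => HdFun muu mau maa KD Vu VN KI ke ka ku qus qas (sol.q t) (sol.qd t))
      (-(ydSig mau maa ka ku sol.q sol.qd t ⬝ᵥ KP *ᵥ ydSig mau maa ka ku sol.q sol.qd t))
      (Ici 0) t := by
    intro t ht
    refine HasDerivWithinAt.congr_deriv (HasDerivWithinAt.congr
      ((((sol.hasDerivWithinAt_energy hmuu hmau hM hVu ht).const_mul (ke * ku)).fun_add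
      (((sol.hasDerivWithinAt_actuated_momentum hmuu hmau ht).half_quadratic hinv).const_mul
        (ke * (ka - ku)))).fun_add ((sol.hydd t ht).half_quadratic hKDs) |>.fun_add
      ((sol.hz₁ t ht).half_quadratic hKIs)) hH (hH t ht)) ?_
    have hPID := congrArg (fun z => ydSig mau maa ka ku sol.q sol.qd t ⬝ᵥ z) (sol.hPID t ht)
    simp only [dotProduct_smul, dotProduct_neg, dotProduct_add, smul_eq_mul] at hPID
    have hyu : ydSig mau maa ka ku sol.q sol.qd t ⬝ᵥ (sol.τ t - grad Va (sol.q t ∘ Sum.inr)) =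
        ku * ((sol.qd t ∘ Sum.inr) ⬝ᵥ (sol.τ t - grad Va (sol.q t ∘ Sum.inr)))
        + (ka - ku) *
          ((mau (sol.q t ∘ Sum.inl) *ᵥ (sol.qd t ∘ Sum.inl) + maa *ᵥ (sol.qd t ∘ Sum.inr)) ⬝ᵥ
            maa⁻¹ *ᵥ (sol.τ t - grad Va (sol.q t ∘ Sum.inr))) := by
      rw [hinv.dotProduct_mulVec_comm, dotProduct_comm _ (maa⁻¹ *ᵥ _), mulVec_add, mulVec_mulVec,
        mulVec_mulVec, nonsing_inv_mul _ hunit, one_mulVec, ydSig, yA, yU, mulVec_mulVec]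
      simp only [add_dotProduct, smul_dotProduct, neg_dotProduct, smul_eq_mul]
      ring
    rw [hyu] at hPID
    rw [hKIs.dotProduct_mulVec_comm]
    linarith
  refine antitoneOn_of_hasDerivWithinAt_nonpos (convex_Ici 0)
    (fun t ht => (hderiv t ht).continuousWithinAt)
    (fun t ht => (hderiv t (interior_subset ht)).mono interior_subset) fun t _ => ?_
  have := hKP.posSemidef.dotProduct_mulVec_nonneg (ydSig mau maa ka ku sol.q sol.qd t)
  rw [star_trivial] at this
  linarith

end Solutions

theorem continuous_HdFun (hmuu : ∀ i j, ContDiff ℝ (⊤ : ℕ∞) fun x => muu x i j)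
    (hmau : ∀ i j, ContDiff ℝ (⊤ : ℕ∞) fun x => mau x i j) {Vu : (Fin s → ℝ) → ℝ}
    (hVu : Continuous Vu) {VN : (Fin s → ℝ) → Fin m → ℝ} (hVN : Continuous VN)
    (KI KD : Matrix (Fin m) (Fin m) ℝ) (ke ka ku : ℝ) (qus : Fin s → ℝ) (qas : Fin m → ℝ) :
    Continuous fun x : (Fin s ⊕ Fin m → ℝ) × (Fin s ⊕ Fin m → ℝ) =>
      HdFun muu mau maa KD Vu VN KI ke ka ku qus qas x.1 x.2 := by
  have hl : Continuous fun x : (Fin s ⊕ Fin m → ℝ) × (Fin s ⊕ Fin m → ℝ) => x.1 ∘ Sum.inl := by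
    fun_prop
  have huu : Continuous fun x : (Fin s ⊕ Fin m → ℝ) × (Fin s ⊕ Fin m → ℝ) =>
      muu (x.1 ∘ Sum.inl) :=
    (continuous_matrix fun i j => (hmuu i j).continuous).comp hl
  have hau : Continuous fun x : (Fin s ⊕ Fin m → ℝ) × (Fin s ⊕ Fin m → ℝ) =>
      mau (x.1 ∘ Sum.inl) :=
    (continuous_matrix fun i j => (hmau i j).continuous).comp hl
  have hz : Continuous fun x : (Fin s ⊕ Fin m → ℝ) × (Fin s ⊕ Fin m → ℝ) =>
      ka • (x.1 ∘ Sum.inr - qas) + (ka - ku) • (VN (x.1 ∘ Sum.inl) - VN qus) := by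
    fun_prop
  have hMd : Continuous fun x : (Fin s ⊕ Fin m → ℝ) × (Fin s ⊕ Fin m → ℝ) =>
      MdMat muu mau maa KD ke ka ku (x.1 ∘ Sum.inl) := by
    have hta := hau.matrix_transpose.matrix_mul (continuous_const (y := maa⁻¹))
    have htaD := hta.matrix_mul (continuous_const (y := KD))
    have hDa := (continuous_const (y := KD * maa⁻¹)).matrix_mul hau
    exact Continuous.matrix_fromBlocks
      ((((huu.sub (hta.matrix_mul hau)).const_smul (ke * ku)).add
        ((hta.matrix_mul hau).const_smul (ke * ka))).add
        (((htaD.matrix_mul continuous_const).matrix_mul hau).const_smul ((ka - ku) ^ 2)))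
      ((hau.matrix_transpose.const_smul (ke * ka)).add (htaD.const_smul (ka * (ka - ku))))
      ((hau.const_smul (ke * ka)).add (hDa.const_smul (ka * (ka - ku))))
      continuous_const
  exact (continuous_const.mul
    (continuous_snd.dotProduct (hMd.matrix_mulVec continuous_snd))).add
    ((continuous_const.mul (hVu.comp hl)).add
      (continuous_const.mul (hz.dotProduct (continuous_const.matrix_mulVec hz))))

end Blocks

theorem norm_lt_of_dotProduct_self_lt {ι : Type*} [Fintype ι] {x : ι → ℝ} {η : ℝ} (hη : 0 < η)
    (h : x ⬝ᵥ x < η ^ 2) : ‖x‖ < η := by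
  refine (pi_norm_lt_iff hη).2 fun i => abs_lt_of_sq_lt_sq (lt_of_le_of_lt ?_ h) hη.le
  rw [sq]
  exact Finset.single_le_sum (f := fun i => x i * x i) (fun i _ => mul_self_nonneg _)
    (Finset.mem_univ i)

/-- Proposition 3(i): under Assumption A7 (`M_d > 0` and `V_d` with a
strict isolated minimum at `q* = (q_u*, q_a*)`, where `∇V_u(q_u*) = 0`), the equilibrium
`(q*, 0)` is Lyapunov stable for the PID-PBC closed loop with integrator initialization
`z₁(0) = k_a(q_a(0) − q_a*) + (k_a − k_u)(V_N(q_u(0)) − V_N(q_u*))`, and `H_d` is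
nonincreasing along all such solutions. -/
theorem prop3_lyapunov_stability
    {s m : ℕ} (hs : 1 ≤ s) (hm : 1 ≤ m)
    (muu : (Fin s → ℝ) → Matrix (Fin s) (Fin s) ℝ)
    (mau : (Fin s → ℝ) → Matrix (Fin m) (Fin s) ℝ)
    (maa : Matrix (Fin m) (Fin m) ℝ)
    (hmuu : ∀ i j, ContDiff ℝ (⊤ : ℕ∞) fun x => muu x i j)
    (hmau : ∀ i j, ContDiff ℝ (⊤ : ℕ∞) fun x => mau x i j)
    (hmaa : maa.IsSymm)
    (hM : ∀ qu, (Mblk muu mau maa qu).PosDef)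
    (Vu : (Fin s → ℝ) → ℝ) (Va : (Fin m → ℝ) → ℝ)
    (hVu : ContDiff ℝ (⊤ : ℕ∞) Vu) (hVa : ContDiff ℝ (⊤ : ℕ∞) Va)
    (hVubdd : ∃ c : ℝ, ∀ x, c ≤ Vu x)
    (ke ka ku : ℝ) (hke : ke ≠ 0) (hka : ka ≠ 0) (hku : ku ≠ 0) (hkaku : ka ≠ ku)
    (KP KI KD : Matrix (Fin m) (Fin m) ℝ)
    (hKP : KP.PosDef) (hKI : KI.PosDef) (hKD : KD.PosSemidef)
    (VN : (Fin s → ℝ) → Fin m → ℝ) (hVNs : ContDiff ℝ (⊤ : ℕ∞) VN)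
    (hVN : ∀ x v, fderiv ℝ VN x v = (maa⁻¹ * mau x) *ᵥ v)
    (qus : Fin s → ℝ) (hcrit : grad Vu qus = 0) (qas : Fin m → ℝ)
    (hMd : ∀ qu, (MdMat muu mau maa KD ke ka ku qu).PosDef)
    (hmin : ∃ r > (0:ℝ), ∀ x : (Fin s ⊕ Fin m) → ℝ, x ≠ Sum.elim qus qas →
      (x - Sum.elim qus qas) ⬝ᵥ (x - Sum.elim qus qas) < r^2 →
      VdFun Vu VN KI ke ka ku qus qas (Sum.elim qus qas) < VdFun Vu VN KI ke ka ku qus qas x) :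
    (∀ ε > (0:ℝ), ∃ δ > (0:ℝ),
      ∀ sol : Sol muu mau maa Vu Va ke ka ku KP KI KD,
        sol.z₁ 0 = ka • (sol.q 0 ∘ Sum.inr - qas)
            + (ka - ku) • (VN (sol.q 0 ∘ Sum.inl) - VN qus) →
        (sol.q 0 - Sum.elim qus qas) ⬝ᵥ (sol.q 0 - Sum.elim qus qas)
            + sol.qd 0 ⬝ᵥ sol.qd 0 < δ^2 →
        ∀ t ∈ Ici (0:ℝ),
          (sol.q t - Sum.elim qus qas) ⬝ᵥ (sol.q t - Sum.elim qus qas)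
            + sol.qd t ⬝ᵥ sol.qd t < ε^2)
    ∧ (∀ sol : Sol muu mau maa Vu Va ke ka ku KP KI KD,
        sol.z₁ 0 = ka • (sol.q 0 ∘ Sum.inr - qas)
            + (ka - ku) • (VN (sol.q 0 ∘ Sum.inl) - VN qus) →
        ∀ t₁ ∈ Ici (0:ℝ), ∀ t₂ ∈ Ici (0:ℝ), t₁ ≤ t₂ →
          HdFun muu mau maa KD Vu VN KI ke ka ku qus qas (sol.q t₂) (sol.qd t₂)
            ≤ HdFun muu mau maa KD Vu VN KI ke ka ku qus qas (sol.q t₁) (sol.qd t₁)) := by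
  have hdecr := fun sol h0 => Sol.antitoneOn_HdFun (ke := ke) (ka := ka) (ku := ku) (Va := Va)
    hmuu hmau hmaa hM hVu hKP hKI hKD hVNs hVN qus qas sol h0
  refine ⟨fun ε hε => ?_, fun sol h0 t₁ h₁ t₂ h₂ h => hdecr sol h0 h₁ h₂ h⟩
  obtain ⟨r, hr, hmin⟩ := hmin
  set qs : Fin s ⊕ Fin m → ℝ := Sum.elim qus qas
  set ρ := min ε (r / 2)
  have hρ0 : 0 < ρ := lt_min hε (half_pos hr)
  have hρε : ρ ^ 2 ≤ ε ^ 2 := pow_le_pow_left₀ hρ0.le (min_le_left _ _) 2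
  have hρr : ρ ^ 2 < r ^ 2 :=
    pow_lt_pow_left₀ ((min_le_right _ _).trans_lt (half_lt_self hr)) hρ0.le two_ne_zero
  let W : (Fin s ⊕ Fin m → ℝ) × (Fin s ⊕ Fin m → ℝ) → ℝ :=
    fun x => (x.1 - qs) ⬝ᵥ (x.1 - qs) + x.2 ⬝ᵥ x.2
  let H : (Fin s ⊕ Fin m → ℝ) × (Fin s ⊕ Fin m → ℝ) → ℝ :=
    fun x => HdFun muu mau maa KD Vu VN KI ke ka ku qus qas x.1 x.2
  have hnonneg : ∀ x : Fin s ⊕ Fin m → ℝ, 0 ≤ x ⬝ᵥ x := fun x =>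
    Finset.sum_nonneg fun i _ => mul_self_nonneg (x i)
  have hH : Continuous H :=
    continuous_HdFun hmuu hmau hVu.continuous hVNs.continuous KI KD ke ka ku qus qas
  have hW : Continuous W :=
    ((continuous_fst.sub continuous_const).dotProduct (continuous_fst.sub continuous_const)).add
      (continuous_snd.dotProduct continuous_snd)
  have hball : ∀ η > (0 : ℝ), ∀ x, W x < η ^ 2 → x ∈ Metric.ball (qs, 0) η := by
    intro η hη x hx
    rw [Metric.mem_ball, Prod.dist_eq, max_lt_iff, dist_eq_norm, dist_eq_norm, sub_zero]
    exact ⟨norm_lt_of_dotProduct_self_lt hη (by linarith [hnonneg x.2]),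
      norm_lt_of_dotProduct_self_lt hη (by linarith [hnonneg (x.1 - qs)])⟩
  have hK : IsCompact {x | W x = ρ ^ 2} := by
    refine Metric.isCompact_of_isClosed_isBounded (isClosed_eq hW continuous_const)
      (Metric.isBounded_ball.subset fun x (hx : W x = ρ ^ 2) => hball r hr x ?_)
    rwa [hx]
  have hpos : ∀ x, W x = ρ ^ 2 → H (qs, 0) < H x := by
    rintro ⟨q, v⟩ hx
    have hx' : (q - qs) ⬝ᵥ (q - qs) + v ⬝ᵥ v = ρ ^ 2 := hx
    have hH0 : H (qs, 0) = VdFun Vu VN KI ke ka ku qus qas qs := by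
      simp [H, HdFun]
    rw [hH0]
    change _ < (1/2 : ℝ) * (v ⬝ᵥ MdMat muu mau maa KD ke ka ku (q ∘ Sum.inl) *ᵥ v)
      + VdFun Vu VN KI ke ka ku qus qas q
    by_cases hq : q = qs
    · have hv : v ≠ 0 := by
        rintro rfl
        rw [hq, sub_self, dotProduct_zero, add_zero] at hx'
        exact (pow_pos hρ0 2).ne hx'
      have hkin := (hMd (q ∘ Sum.inl)).dotProduct_mulVec_pos hv
      rw [star_trivial] at hkin
      rw [← hq]
      linarith
    · have hkin := (hMd (q ∘ Sum.inl)).posSemidef.dotProduct_mulVec_nonneg v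
      rw [star_trivial] at hkin
      have := hmin q hq (by linarith [hnonneg v])
      linarith
  obtain ⟨U, hU, htrap⟩ := exists_trapping_radius hH hW hK hpos
  obtain ⟨η, hη, hηU⟩ := Metric.mem_nhds_iff.1 hU
  refine ⟨min η ρ, lt_min hη hρ0, fun sol h0 hinit t ht => ?_⟩
  have hmin0 : 0 ≤ min η ρ := (lt_min hη hρ0).le
  refine (htrap (fun t => (sol.q t, sol.qd t))
    (ContinuousOn.prodMk (fun t ht => (sol.hq t ht).continuousWithinAt)
      fun t ht => (sol.hqd t ht).continuousWithinAt)
    (fun t ht => hdecr sol h0 self_mem_Ici ht ht) (hηU (hball η hη _ ?_)) ?_ t ht).trans_le hρε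
  · exact hinit.trans_le (pow_le_pow_left₀ hmin0 (min_le_left _ _) 2)
  · exact hinit.trans_le (pow_le_pow_left₀ hmin0 (min_le_right _ _) 2)
end
end

section
/- (Proposition 4) Assume additionally that V_a is affine, V_a(q_a) = s_aᵀ q_a + c₀ with s_a ∈ ℝᵐ, c₀ ∈ ℝ (Assumption A8), and that Assumption A6 holds with potential V_N. Define V₀(q_u) := s_aᵀ V_N(q_u), H̄_u(q_u, q̇_u) := ½ q̇_uᵀ m_uu^s(q_u) q̇_u + V_u(q_u) − V₀(q_u), and H̄_a(q, q̇) := ½ q̇ᵀ M_a(q_u) q̇ + V_a(q_a) + V₀(q_u). Then along any trajectory of the mechanical system (with no inner-loop cancellation, i.e. with original control τ): d/dt H̄_u(q_u(t), q̇_u(t)) = τ(t)ᵀ y_u(t) and d/dt H̄_a(q(t), q̇(t)) = τ(t)ᵀ y_a(t) for all t ≥ 0; hence the operators τ ↦ y_u and τ ↦ y_a are passive. -/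
open Matrix Set Filter

noncomputable section

/-- A continuous linear functional on a finite power of `ℝ` is the dot product with its values on
the standard basis. -/
theorem dotProduct_apply_single {ι : Type*} [Fintype ι] [DecidableEq ι]
    (L : (ι → ℝ) →L[ℝ] ℝ) (w : ι → ℝ) :
    (fun j => L (Pi.single j 1)) ⬝ᵥ w = L w := by
  have h := LinearMap.pi_apply_eq_sum_univ (L : (ι → ℝ) →ₗ[ℝ] ℝ) w
  simp only [ContinuousLinearMap.coe_coe, smul_eq_mul] at h
  rw [h, dotProduct]
  refine Finset.sum_congr rfl fun j _ => ?_
  rw [mul_comm]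
  congr 2
  ext i
  simp [Pi.single_apply, eq_comm]

/-- The restriction of a configuration to its unactuated coordinates. -/
def restrictInl (s m : ℕ) : ((Fin s ⊕ Fin m) → ℝ) →L[ℝ] (Fin s → ℝ) :=
  ContinuousLinearMap.pi fun i => ContinuousLinearMap.proj (Sum.inl i)

section Inertia

variable {s m : ℕ} {muu : (Fin s → ℝ) → Matrix (Fin s) (Fin s) ℝ}
  {mau : (Fin s → ℝ) → Matrix (Fin m) (Fin s) ℝ} {maa : Matrix (Fin m) (Fin m) ℝ}

theorem differentiable_Mblk (hmuu : ∀ i j, Differentiable ℝ fun x => muu x i j)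
    (hmau : ∀ i j, Differentiable ℝ fun x => mau x i j) (i j : Fin s ⊕ Fin m) :
    Differentiable ℝ fun x => Mblk muu mau maa x i j := by
  rcases i with i | i <;> rcases j with j | j
  · exact hmuu i j
  · exact hmau j i
  · exact hmau i j
  · exact differentiable_const _

theorem differentiable_Mblk_mulVec (hmuu : ∀ i j, Differentiable ℝ fun x => muu x i j)
    (hmau : ∀ i j, Differentiable ℝ fun x => mau x i j) (v : (Fin s ⊕ Fin m) → ℝ)
    (i : Fin s ⊕ Fin m) :
    Differentiable ℝ fun x => (Mblk muu mau maa x *ᵥ v) i := by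
  unfold Matrix.mulVec dotProduct
  exact Differentiable.fun_sum fun j _ => (differentiable_Mblk hmuu hmau i j).mul_const _

theorem Jmat_mulVec_apply (q v w : (Fin s ⊕ Fin m) → ℝ) (i : Fin s ⊕ Fin m) :
    (Jmat muu mau maa q v *ᵥ w) i =
      fderiv ℝ (fun p : (Fin s ⊕ Fin m) → ℝ =>
        (Mblk muu mau maa (p ∘ Sum.inl) *ᵥ v) i) q w :=
  dotProduct_apply_single _ _

/-- The inertia matrix does not depend on the actuated coordinates. -/
theorem Jmat_apply_inr (hmuu : ∀ i j, Differentiable ℝ fun x => muu x i j)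
    (hmau : ∀ i j, Differentiable ℝ fun x => mau x i j) (q v : (Fin s ⊕ Fin m) → ℝ)
    (i : Fin s ⊕ Fin m) (j : Fin m) :
    Jmat muu mau maa q v i (Sum.inr j) = 0 := by
  have h := ((differentiable_Mblk_mulVec (maa := maa) hmuu hmau v i
    (restrictInl s m q)).hasFDerivAt.comp q (restrictInl s m).hasFDerivAt).fderiv
  have hz : restrictInl s m (Pi.single (Sum.inr j) 1) = 0 := by
    ext k
    simp [restrictInl]
  change fderiv ℝ ((fun x => (Mblk muu mau maa x *ᵥ v) i) ∘ (restrictInl s m)) q _ = 0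
  rw [h, ContinuousLinearMap.comp_apply, hz, map_zero]

theorem Cvec_apply_inr (hmuu : ∀ i j, Differentiable ℝ fun x => muu x i j)
    (hmau : ∀ i j, Differentiable ℝ fun x => mau x i j) (q v : (Fin s ⊕ Fin m) → ℝ)
    (j : Fin m) :
    Cvec muu mau maa q v (Sum.inr j) = (Jmat muu mau maa q v *ᵥ v) (Sum.inr j) := by
  rw [Cvec, sub_mulVec, smul_mulVec, Pi.sub_apply, Pi.smul_apply]
  have h : ((Jmat muu mau maa q v)ᵀ *ᵥ v) (Sum.inr j) = 0 := by
    simp [Matrix.mulVec, dotProduct, Jmat_apply_inr hmuu hmau]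
  rw [h, smul_zero, sub_zero]

theorem dotProduct_Cvec (q v : (Fin s ⊕ Fin m) → ℝ) :
    v ⬝ᵥ Cvec muu mau maa q v = (1/2 : ℝ) * (v ⬝ᵥ Jmat muu mau maa q v *ᵥ v) := by
  have h : v ⬝ᵥ (Jmat muu mau maa q v)ᵀ *ᵥ v = v ⬝ᵥ Jmat muu mau maa q v *ᵥ v := by
    rw [mulVec_transpose, dotProduct_comm, dotProduct_mulVec]
  rw [Cvec, sub_mulVec, smul_mulVec, dotProduct_sub, dotProduct_smul, h, smul_eq_mul]
  ring

/-- The derivative of the generalized momentum `M(q_u) q̇` along a curve. -/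
theorem hasDerivWithinAt_Mblk_mulVec (hmuu : ∀ i j, Differentiable ℝ fun x => muu x i j)
    (hmau : ∀ i j, Differentiable ℝ fun x => mau x i j)
    {q v : ℝ → (Fin s ⊕ Fin m) → ℝ} {a : (Fin s ⊕ Fin m) → ℝ} {S : Set ℝ} {t : ℝ}
    (hq : HasDerivWithinAt q (v t) S t) (hv : HasDerivWithinAt v a S t) :
    HasDerivWithinAt (fun r => Mblk muu mau maa (q r ∘ Sum.inl) *ᵥ v r)
      (Mblk muu mau maa (q t ∘ Sum.inl) *ᵥ a + Jmat muu mau maa (q t) (v t) *ᵥ v t) S t := by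
  rw [hasDerivWithinAt_pi]
  intro i
  have hF : ∀ j, HasFDerivAt
      (fun p : (Fin s ⊕ Fin m) → ℝ => Mblk muu mau maa (p ∘ Sum.inl) i j)
      (fderiv ℝ (fun p : (Fin s ⊕ Fin m) → ℝ => Mblk muu mau maa (p ∘ Sum.inl) i j) (q t))
      (q t) := fun j =>
    ((differentiable_Mblk hmuu hmau i j).comp (restrictInl s m).differentiable
      (q t)).hasFDerivAt
  have hJ : (Jmat muu mau maa (q t) (v t) *ᵥ v t) i = ∑ j,
      fderiv ℝ (fun p : (Fin s ⊕ Fin m) → ℝ => Mblk muu mau maa (p ∘ Sum.inl) i j) (q t) (v t)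
        * v t j := by
    rw [Jmat_mulVec_apply]
    have h := (HasFDerivAt.fun_sum (u := Finset.univ)
      fun j _ => (hF j).mul_const (v t j)).fderiv
    change fderiv ℝ (fun p : (Fin s ⊕ Fin m) → ℝ =>
      ∑ j, Mblk muu mau maa (p ∘ Sum.inl) i j * v t j) (q t) (v t) = _
    rw [h]
    simp [mul_comm]
  have h := HasDerivWithinAt.fun_sum (u := Finset.univ) fun j _ =>
    ((hF j).comp_hasDerivWithinAt t hq).mul (hasDerivWithinAt_pi.1 hv j)
  refine h.congr_deriv ?_
  rw [Pi.add_apply, hJ, Finset.sum_add_distrib, add_comm]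
  rfl

end Inertia

theorem HasDerivWithinAt.dotProduct_s16 {ι : Type*} [Fintype ι] {f g : ℝ → ι → ℝ} {f' g' : ι → ℝ}
    {S : Set ℝ} {t : ℝ} (hf : HasDerivWithinAt f f' S t) (hg : HasDerivWithinAt g g' S t) :
    HasDerivWithinAt (fun r => f r ⬝ᵥ g r) (f' ⬝ᵥ g t + f t ⬝ᵥ g') S t := by
  refine (HasDerivWithinAt.fun_sum (u := Finset.univ) fun i _ =>
    (hasDerivWithinAt_pi.1 hf i).mul (hasDerivWithinAt_pi.1 hg i)).congr_deriv ?_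
  rw [Finset.sum_add_distrib]
  rfl

theorem HasDerivWithinAt.mulVec_const {ι κ : Type*} [Fintype ι] [Fintype κ]
    (A : Matrix κ ι ℝ) {f : ℝ → ι → ℝ} {f' : ι → ℝ} {S : Set ℝ} {t : ℝ}
    (hf : HasDerivWithinAt f f' S t) :
    HasDerivWithinAt (fun r => A *ᵥ f r) (A *ᵥ f') S t :=
  (LinearMap.toContinuousLinearMap A.mulVecLin).hasFDerivAt.comp_hasDerivWithinAt t hf

theorem dotProduct_mulVec_symm {ι : Type*} [Fintype ι] {A : Matrix ι ι ℝ} (hA : A.IsSymm)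
    (x y : ι → ℝ) : x ⬝ᵥ A *ᵥ y = y ⬝ᵥ A *ᵥ x := by
  rw [dotProduct_mulVec, ← mulVec_transpose, hA.eq, dotProduct_comm]

section Splitting

variable {s m : ℕ} (muu : (Fin s → ℝ) → Matrix (Fin s) (Fin s) ℝ)
  (mau : (Fin s → ℝ) → Matrix (Fin m) (Fin s) ℝ) {maa : Matrix (Fin m) (Fin m) ℝ}

theorem Mblk_mulVec_comp_inr (maa : Matrix (Fin m) (Fin m) ℝ) (x : Fin s → ℝ)
    (v : (Fin s ⊕ Fin m) → ℝ) :
    (Mblk muu mau maa x *ᵥ v) ∘ Sum.inr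
      = mau x *ᵥ (v ∘ Sum.inl) + maa *ᵥ (v ∘ Sum.inr) := by
  rw [Mblk, fromBlocks_mulVec]
  rfl

/-- The passive output `y_a` is the actuated momentum divided by the actuated inertia. -/
theorem yA_eq (hdet : IsUnit maa.det) (x : Fin s → ℝ) (v : (Fin s ⊕ Fin m) → ℝ) :
    yA mau maa x (v ∘ Sum.inl) (v ∘ Sum.inr)
      = maa⁻¹ *ᵥ ((Mblk muu mau maa x *ᵥ v) ∘ Sum.inr) := by
  rw [Mblk_mulVec_comp_inr, yA, mulVec_add, mulVec_mulVec (v ∘ Sum.inr),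
    nonsing_inv_mul _ hdet, one_mulVec]

/-- The kinetic energy is the sum of the kinetic parts of the two storage functions. -/
theorem dotProduct_Mblk (x : Fin s → ℝ) (v : (Fin s ⊕ Fin m) → ℝ) :
    v ⬝ᵥ Mblk muu mau maa x *ᵥ v
      = (v ∘ Sum.inl) ⬝ᵥ muuS muu mau maa x *ᵥ (v ∘ Sum.inl)
        + v ⬝ᵥ MaMat mau maa x *ᵥ v := by
  obtain ⟨a, b, rfl⟩ : ∃ a b, v = Sum.elim a b := ⟨_, _, (Sum.elim_comp_inl_inr v).symm⟩
  simp only [Mblk, MaMat, muuS, fromBlocks_mulVec, Sum.elim_comp_inl, Sum.elim_comp_inr,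
    sumElim_dotProduct_sumElim, sub_mulVec, dotProduct_add, dotProduct_sub]
  ring

theorem dotProduct_MaMat (hmaa : maa.IsSymm) (hdet : IsUnit maa.det) (x : Fin s → ℝ)
    (v : (Fin s ⊕ Fin m) → ℝ) :
    v ⬝ᵥ MaMat mau maa x *ᵥ v
      = ((Mblk muu mau maa x *ᵥ v) ∘ Sum.inr)
          ⬝ᵥ maa⁻¹ *ᵥ ((Mblk muu mau maa x *ᵥ v) ∘ Sum.inr) := by
  rw [← yA_eq muu mau hdet, Mblk_mulVec_comp_inr, yA]
  obtain ⟨a, b, rfl⟩ : ∃ a b, v = Sum.elim a b := ⟨_, _, (Sum.elim_comp_inl_inr v).symm⟩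
  have h₁ : (maa *ᵥ b) ⬝ᵥ maa⁻¹ *ᵥ (mau x *ᵥ a) = b ⬝ᵥ mau x *ᵥ a := by
    rw [dotProduct_comm, dotProduct_mulVec_symm hmaa, mulVec_mulVec, mul_nonsing_inv _ hdet,
      one_mulVec]
  have h₂ : ∀ w, a ⬝ᵥ (mau x)ᵀ *ᵥ w = (mau x *ᵥ a) ⬝ᵥ w := fun w => by
    rw [mulVec_transpose, dotProduct_comm, ← dotProduct_mulVec, dotProduct_comm]
  simp only [MaMat, fromBlocks_mulVec, Sum.elim_comp_inl, Sum.elim_comp_inr,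
    sumElim_dotProduct_sumElim, dotProduct_add, add_dotProduct, h₁, ← mulVec_mulVec, h₂,
    dotProduct_comm (maa *ᵥ b) b]
  ring

end Splitting

/-- Proposition 4: if `V_a(q_a) = s_aᵀ q_a + c₀` (Assumption A8) and A6
holds with potential `V_N`, then without the inner-loop cancellation the operators
`τ ↦ y_u` and `τ ↦ y_a` are passive with storage functions
`H̄_u = ½ q̇_uᵀ m_uu^s q̇_u + V_u − V₀` and `H̄_a = ½ q̇ᵀ M_a q̇ + V_a + V₀`, where
`V₀(q_u) = s_aᵀ V_N(q_u)`: along any trajectory `d/dt H̄_u = τᵀ y_u` and `d/dt H̄_a = τᵀ y_a`. -/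
theorem prop4_no_cancellation
    {s m : ℕ} (hs : 1 ≤ s) (hm : 1 ≤ m)
    (muu : (Fin s → ℝ) → Matrix (Fin s) (Fin s) ℝ)
    (mau : (Fin s → ℝ) → Matrix (Fin m) (Fin s) ℝ)
    (maa : Matrix (Fin m) (Fin m) ℝ)
    (hmuu : ∀ i j, ContDiff ℝ (⊤ : ℕ∞) fun x => muu x i j)
    (hmau : ∀ i j, ContDiff ℝ (⊤ : ℕ∞) fun x => mau x i j)
    (hmaa : maa.IsSymm)
    (hM : ∀ qu, (Mblk muu mau maa qu).PosDef)
    (Vu : (Fin s → ℝ) → ℝ) (Va : (Fin m → ℝ) → ℝ)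
    (hVu : ContDiff ℝ (⊤ : ℕ∞) Vu) (hVa : ContDiff ℝ (⊤ : ℕ∞) Va)
    (hVubdd : ∃ c : ℝ, ∀ x, c ≤ Vu x)
    (sa : Fin m → ℝ) (c₀ : ℝ) (hVaAffine : ∀ x, Va x = sa ⬝ᵥ x + c₀)
    (VN : (Fin s → ℝ) → Fin m → ℝ) (hVNs : ContDiff ℝ (⊤ : ℕ∞) VN)
    (hVN : ∀ x v, fderiv ℝ VN x v = (maa⁻¹ * mau x) *ᵥ v)
    (q qd qdd : ℝ → (Fin s ⊕ Fin m) → ℝ)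
    (τ : ℝ → Fin m → ℝ) (hτ : ContinuousOn τ (Ici 0))
    (hq : ∀ t ∈ Ici (0:ℝ), HasDerivWithinAt q (qd t) (Ici 0) t)
    (hqd : ∀ t ∈ Ici (0:ℝ), HasDerivWithinAt qd (qdd t) (Ici 0) t)
    (hqdd : ContinuousOn qdd (Ici 0))
    (hEL : ∀ t ∈ Ici (0:ℝ),
      Mblk muu mau maa (q t ∘ Sum.inl) *ᵥ qdd t
        + Cvec muu mau maa (q t) (qd t)
        + Sum.elim (grad Vu (q t ∘ Sum.inl)) (grad Va (q t ∘ Sum.inr))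
      = Sum.elim (0 : Fin s → ℝ) (τ t))
 :
    (∀ t ∈ Ici (0:ℝ),
      HasDerivWithinAt
        (fun t => Hu muu mau maa Vu (q t ∘ Sum.inl) (qd t ∘ Sum.inl)
            - sa ⬝ᵥ VN (q t ∘ Sum.inl))
        (τ t ⬝ᵥ yU mau maa (q t ∘ Sum.inl) (qd t ∘ Sum.inl))
        (Ici 0) t)
    ∧ (∀ t ∈ Ici (0:ℝ),
      HasDerivWithinAt
        (fun t => Ha mau maa (q t ∘ Sum.inl) (qd t) + Va (q t ∘ Sum.inr)
            + sa ⬝ᵥ VN (q t ∘ Sum.inl))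
        (τ t ⬝ᵥ yA mau maa (q t ∘ Sum.inl) (qd t ∘ Sum.inl) (qd t ∘ Sum.inr))
        (Ici 0) t) := by
  have hmuu' : ∀ i j, Differentiable ℝ fun x => muu x i j := fun i j =>
    (hmuu i j).differentiable (by simp)
  have hmau' : ∀ i j, Differentiable ℝ fun x => mau x i j := fun i j =>
    (hmau i j).differentiable (by simp)
  have hdet : IsUnit maa.det :=
    ((hM 0).submatrix (e := Sum.inr) Sum.inr_injective).det_pos.ne'.isUnit
  have hMsymm : ∀ x, (Mblk muu mau maa x).IsSymm := fun x => by
    simpa [Matrix.IsHermitian, Matrix.IsSymm] using (hM x).isHermitian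
  have hinv : maa⁻¹.IsSymm := by rw [Matrix.IsSymm, transpose_nonsing_inv, hmaa.eq]
  have hqu : ∀ t ∈ Ici (0:ℝ),
      HasDerivWithinAt (fun r => q r ∘ Sum.inl) (qd t ∘ Sum.inl) (Ici 0) t := fun t ht =>
    hasDerivWithinAt_pi.2 fun i => hasDerivWithinAt_pi.1 (hq t ht) (Sum.inl i)
  have hqa : ∀ t ∈ Ici (0:ℝ),
      HasDerivWithinAt (fun r => q r ∘ Sum.inr) (qd t ∘ Sum.inr) (Ici 0) t := fun t ht =>
    hasDerivWithinAt_pi.2 fun i => hasDerivWithinAt_pi.1 (hq t ht) (Sum.inr i)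
  have hVaDeriv : ∀ x v, fderiv ℝ Va x v = sa ⬝ᵥ v := fun x v => by
    have h : HasFDerivAt Va (LinearMap.toContinuousLinearMap (dotProductBilin ℝ ℝ sa)) x := by
      rw [show Va = fun x => sa ⬝ᵥ x + c₀ from funext hVaAffine]
      exact (LinearMap.toContinuousLinearMap (dotProductBilin ℝ ℝ sa)).hasFDerivAt.add_const c₀
    rw [h.fderiv]
    rfl
  have hgradVa : ∀ x, grad Va x = sa := fun x => by
    ext i
    simp [grad, hVaDeriv]
  have hVat : ∀ t ∈ Ici (0:ℝ),
      HasDerivWithinAt (fun r => Va (q r ∘ Sum.inr)) (sa ⬝ᵥ (qd t ∘ Sum.inr)) (Ici 0) t :=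
    fun t ht => (((hVa.differentiable (by simp) _).hasFDerivAt).comp_hasDerivWithinAt t
      (hqa t ht)).congr_deriv (hVaDeriv _ _)
  have hV₀t : ∀ t ∈ Ici (0:ℝ),
      HasDerivWithinAt (fun r => sa ⬝ᵥ VN (q r ∘ Sum.inl))
        (sa ⬝ᵥ maa⁻¹ *ᵥ (mau (q t ∘ Sum.inl) *ᵥ (qd t ∘ Sum.inl))) (Ici 0) t := fun t ht => by
    have h := ((hVNs.differentiable (by simp) _).hasFDerivAt).comp_hasDerivWithinAt t (hqu t ht)
    refine ((hasDerivWithinAt_const t _ sa).dotProduct_s16 h).congr_deriv ?_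
    rw [hVN, zero_dotProduct, zero_add, mulVec_mulVec]
  have hp := fun t ht =>
    hasDerivWithinAt_Mblk_mulVec (maa := maa) hmuu' hmau' (hq t ht) (hqd t ht)
  have hpa : ∀ t ∈ Ici (0:ℝ), HasDerivWithinAt
      (fun r => (Mblk muu mau maa (q r ∘ Sum.inl) *ᵥ qd r) ∘ Sum.inr) (τ t - sa) (Ici 0) t :=
    fun t ht => by
      rw [hasDerivWithinAt_pi]
      intro j
      refine (hasDerivWithinAt_pi.1 (hp t ht) (Sum.inr j)).congr_deriv ?_
      have h := congrFun (hEL t ht) (Sum.inr j)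
      simp only [Pi.add_apply, Sum.elim_inr, Cvec_apply_inr hmuu' hmau', hgradVa] at h
      simp only [Pi.add_apply, Pi.sub_apply]
      linarith
  have hHa : ∀ t ∈ Ici (0:ℝ),
      HasDerivWithinAt
        (fun t => Ha mau maa (q t ∘ Sum.inl) (qd t) + Va (q t ∘ Sum.inr)
            + sa ⬝ᵥ VN (q t ∘ Sum.inl))
        (τ t ⬝ᵥ yA mau maa (q t ∘ Sum.inl) (qd t ∘ Sum.inl) (qd t ∘ Sum.inr))
        (Ici 0) t := fun t ht => by
    simp only [Ha, dotProduct_MaMat muu mau hmaa hdet]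
    refine (((((hpa t ht).dotProduct_s16 ((hpa t ht).mulVec_const maa⁻¹)).const_mul (1/2)).add
      (hVat t ht)).add (hV₀t t ht)).congr_deriv ?_
    rw [dotProduct_mulVec_symm hinv _ (τ t - sa), ← yA_eq muu mau hdet, yA]
    simp only [sub_dotProduct, dotProduct_add]
    ring
  have hE : ∀ t ∈ Ici (0:ℝ),
      HasDerivWithinAt
        (fun t => (1/2 : ℝ) * (qd t ⬝ᵥ Mblk muu mau maa (q t ∘ Sum.inl) *ᵥ qd t)
          + Vu (q t ∘ Sum.inl) + Va (q t ∘ Sum.inr))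
        (τ t ⬝ᵥ (qd t ∘ Sum.inr)) (Ici 0) t := fun t ht => by
    have hVut := ((hVu.differentiable (by simp) _).hasFDerivAt).comp_hasDerivWithinAt t (hqu t ht)
    refine (((((hqd t ht).dotProduct_s16 (hp t ht)).const_mul (1/2)).add hVut).add
      (hVat t ht)).congr_deriv ?_
    have h := congrArg (fun w => qd t ⬝ᵥ w) (hEL t ht)
    have hsplit : ∀ a b, qd t ⬝ᵥ Sum.elim a b
        = (qd t ∘ Sum.inl) ⬝ᵥ a + (qd t ∘ Sum.inr) ⬝ᵥ b := fun a b => by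
      rw [← sumElim_dotProduct_sumElim, Sum.elim_comp_inl_inr]
    simp only [dotProduct_add, dotProduct_Cvec, hgradVa, hsplit, dotProduct_zero] at h
    rw [dotProduct_comm _ (grad Vu _), grad_dotProduct, dotProduct_comm _ sa,
      dotProduct_comm _ (τ t)] at h
    rw [dotProduct_mulVec_symm (hMsymm _) (qdd t), dotProduct_add]
    linarith
  refine ⟨fun t ht => ?_, hHa⟩
  have h := (hE t ht).sub (hHa t ht)
  refine (h.congr_deriv ?_).congr_of_eventuallyEq (.of_forall fun r => ?_) ?_
  · rw [yA, yU, dotProduct_add, dotProduct_neg]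
    ring
  all_goals
    simp only [Pi.sub_apply, Hu, Ha, dotProduct_Mblk]
    ring
end
end
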